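/- In the two-participant tontine fund with an active administrator, with investments π_1, π_2, π_3 ≥ 0 such that π_1 + π_2 > 0, the scheme with compensations W_i = (π_1 + π_2 + π_3) · P_i (i = 1,2,3) is actuarially fair for all three agents (π_i = E[W_i] for i = 1,2,3) if and only if π_1 = π_3 · p_1 · (q_2 + β·p_2) / (q_1·q_2) and π_2 = π_3 · p_2 · (q_1 + (1−β)·p_1) / (q_1·q_2). -/

import Mathlib

open MeasureTheory

/-- A function with values in `{0, 1}` integrates to the probability that it equals `1`. -/
theorem integral_eq_measure_of_zero_or_one {Ω : Type*} [MeasurableSpace Ω] (μ : Measure Ω)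
    {I : Ω → ℝ} (hm : Measurable I) (h : ∀ ω, I ω = 0 ∨ I ω = 1) :
    ∫ ω, I ω ∂μ = (μ {ω | I ω = 1}).toReal := by
  have hI : I = Set.indicator {ω | I ω = 1} 1 := by
    ext ω
    rcases h ω with h | h <;> simp [Set.indicator, h]
  have hs : MeasurableSet {ω | I ω = 1} := hm (measurableSet_singleton 1)
  calc ∫ ω, I ω ∂μ = ∫ ω, Set.indicator {ω | I ω = 1} 1 ω ∂μ := by rw [← hI]
    _ = (μ {ω | I ω = 1}).toReal := integral_indicator_one hs

theorem integrable_of_zero_or_one {Ω : Type*} [MeasurableSpace Ω] (μ : Measure Ω)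
    [IsFiniteMeasure μ] {I : Ω → ℝ} (hm : Measurable I) (h : ∀ ω, I ω = 0 ∨ I ω = 1) :
    Integrable I μ :=
  Integrable.of_bound hm.aestronglyMeasurable 1 <| Filter.Eventually.of_forall fun ω => by
    rcases h ω with h | h <;> simp [h]

/-- The expectation of a bilinear expression in two independent `{0, 1}`-valued variables. -/
theorem integral_bilinear_of_zero_or_one {Ω : Type*} [MeasurableSpace Ω] (μ : Measure Ω)
    [IsProbabilityMeasure μ] {I J : Ω → ℝ} (hI : Measurable I) (hJ : Measurable J)
    (hI01 : ∀ ω, I ω = 0 ∨ I ω = 1) (hJ01 : ∀ ω, J ω = 0 ∨ J ω = 1)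
    (hindep : ProbabilityTheory.IndepFun I J μ) (a b c d : ℝ) :
    ∫ ω, (a + b * I ω + c * J ω + d * (I ω * J ω)) ∂μ =
      a + b * (μ {ω | I ω = 1}).toReal + c * (μ {ω | J ω = 1}).toReal +
        d * ((μ {ω | I ω = 1}).toReal * (μ {ω | J ω = 1}).toReal) := by
  have hIi := integrable_of_zero_or_one μ hI hI01
  have hJi := integrable_of_zero_or_one μ hJ hJ01
  have hIJi : Integrable (fun ω => I ω * J ω) μ := hindep.integrable_mul hIi hJi
  have hIJ : ∫ ω, I ω * J ω ∂μ = (∫ ω, I ω ∂μ) * ∫ ω, J ω ∂μ :=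
    hindep.integral_fun_mul_eq_mul_integral hI.aestronglyMeasurable hJ.aestronglyMeasurable
  rw [integral_add (by fun_prop) (by fun_prop), integral_add (by fun_prop) (by fun_prop),
    integral_add (by fun_prop) (by fun_prop)]
  simp only [integral_const_mul, hIJ, integral_eq_measure_of_zero_or_one μ hI hI01,
    integral_eq_measure_of_zero_or_one μ hJ hJ01]
  simp

/-- Two-participant tontine setup: independent Bernoulli indicators `I1, I2`
with success probabilities `p1, p2 ∈ (0,1)`, and the piecewise relative
compensation vector `(P1, P2, P3)` with sharing parameter `β`. -/
theorem stmt_10 {Ω : Type*} [MeasurableSpace Ω] (μ : Measure Ω) [IsProbabilityMeasure μ]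
    (I1 I2 : Ω → ℝ) (hm1 : Measurable I1) (hm2 : Measurable I2)
    (h01I1 : ∀ ω, I1 ω = 0 ∨ I1 ω = 1) (h01I2 : ∀ ω, I2 ω = 0 ∨ I2 ω = 1)
    (hindep : ProbabilityTheory.IndepFun I1 I2 μ)
    (p1 p2 : ℝ) (hp1 : p1 ∈ Set.Ioo (0 : ℝ) 1) (hp2 : p2 ∈ Set.Ioo (0 : ℝ) 1)
    (hI1 : (μ {ω | I1 ω = 1}).toReal = p1) (hI2 : (μ {ω | I2 ω = 1}).toReal = p2)
    (β : ℝ) (hβ : β ∈ Set.Icc (0 : ℝ) 1)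
    (P1 P2 P3 : Ω → ℝ)
    (hP1 : ∀ ω, P1 ω = if I1 ω = 1 then (if I2 ω = 1 then β else 1) else 0)
    (hP2 : ∀ ω, P2 ω = if I2 ω = 1 then (if I1 ω = 1 then 1 - β else 1) else 0)
    (hP3 : ∀ ω, P3 ω = if I1 ω = 1 then 0 else (if I2 ω = 1 then 0 else 1))
    (π1 π2 π3 : ℝ) (hπ1 : 0 ≤ π1) (hπ2 : 0 ≤ π2) (hπ3 : 0 ≤ π3)
    (hpos : 0 < π1 + π2) :
    (π1 = ∫ ω, (π1 + π2 + π3) * P1 ω ∂μ ∧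
     π2 = ∫ ω, (π1 + π2 + π3) * P2 ω ∂μ ∧
     π3 = ∫ ω, (π1 + π2 + π3) * P3 ω ∂μ) ↔
    (π1 = π3 * p1 * ((1 - p2) + β * p2) / ((1 - p1) * (1 - p2)) ∧
     π2 = π3 * p2 * ((1 - p1) + (1 - β) * p1) / ((1 - p1) * (1 - p2))) := by
  have hint := integral_bilinear_of_zero_or_one μ hm1 hm2 h01I1 h01I2 hindep
  rw [hI1, hI2] at hint
  have e1 : ∫ ω, P1 ω ∂μ = p1 * ((1 - p2) + β * p2) := by
    have h : P1 = fun ω => 0 + 1 * I1 ω + 0 * I2 ω + (β - 1) * (I1 ω * I2 ω) := by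
      ext ω
      rcases h01I1 ω with h1 | h1 <;> rcases h01I2 ω with h2 | h2 <;> simp [hP1, h1, h2]
    rw [h, hint]
    ring
  have e2 : ∫ ω, P2 ω ∂μ = p2 * ((1 - p1) + (1 - β) * p1) := by
    have h : P2 = fun ω => 0 + 0 * I1 ω + 1 * I2 ω + (-β) * (I1 ω * I2 ω) := by
      ext ω
      rcases h01I1 ω with h1 | h1 <;> rcases h01I2 ω with h2 | h2 <;>
        simp [hP2, h1, h2, sub_eq_add_neg]
    rw [h, hint]
    ring
  have e3 : ∫ ω, P3 ω ∂μ = (1 - p1) * (1 - p2) := by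
    have h : P3 = fun ω => 1 + (-1) * I1 ω + (-1) * I2 ω + 1 * (I1 ω * I2 ω) := by
      ext ω
      rcases h01I1 ω with h1 | h1 <;> rcases h01I2 ω with h2 | h2 <;> simp [hP3, h1, h2]
    rw [h, hint]
    ring
  simp only [integral_const_mul, e1, e2, e3]
  have hq : (1 - p1) * (1 - p2) ≠ 0 :=
    mul_ne_zero (sub_ne_zero.2 hp1.2.ne') (sub_ne_zero.2 hp2.2.ne')
  rw [eq_div_iff hq, eq_div_iff hq]
  constructor
  · rintro ⟨h1, h2, h3⟩
    constructor
    · linear_combination ((1 - p1) * (1 - p2)) * h1 - p1 * ((1 - p2) + β * p2) * h3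
    · linear_combination ((1 - p1) * (1 - p2)) * h2 - p2 * ((1 - p1) + (1 - β) * p1) * h3
  · rintro ⟨h1, h2⟩
    have h3 : π3 = (π1 + π2 + π3) * ((1 - p1) * (1 - p2)) := by
      linear_combination -h1 - h2
    refine ⟨mul_right_cancel₀ hq ?_, mul_right_cancel₀ hq ?_, h3⟩
    · linear_combination h1 + p1 * ((1 - p2) + β * p2) * h3
    · linear_combination h2 + p2 * ((1 - p1) + (1 - β) * p1) * h3
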